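/- arXiv:2110.14831 — 5 statements merged into one kernel-verified Lean document; each statement's English description precedes it below -/
import Mathlib

section
/- Under ignorability (W ⫫ (Y(0),Y(1)) | X), overlap (e(X) > 0 almost surely), and integrability E|Y(1)| < ∞, the inverse-propensity-weighted mean identifies the treated mean: E[W·Y / e(X)] = E[Y(1)] = μ1. -/
open MeasureTheory ProbabilityTheory

/-- Pull-out property of the conditional expectation for lower integrals: a nonnegative weight
measurable with respect to the conditioning σ-algebra cannot distinguish a nonnegative integrable
function from its conditional expectation. -/
lemma lintegral_mul_ofReal_condExp {Ω : Type*} {m m₀ : MeasurableSpace Ω} (hm : m ≤ m₀)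
    {μ : Measure Ω} [SigmaFinite (μ.trim hm)] {f : Ω → ℝ} (hf : Integrable f μ)
    (hf_nonneg : 0 ≤ᵐ[μ] f) {g : Ω → ENNReal} (hg : Measurable[m] g) :
    ∫⁻ ω, g ω * ENNReal.ofReal ((μ[f | m]) ω) ∂μ = ∫⁻ ω, g ω * ENNReal.ofReal (f ω) ∂μ := by
  have hf' : AEMeasurable (fun ω => ENNReal.ofReal (f ω)) μ := hf.aemeasurable.ennreal_ofReal
  have hc' : AEMeasurable (fun ω => ENNReal.ofReal ((μ[f | m]) ω)) μ :=
    integrable_condExp.aemeasurable.ennreal_ofReal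
  have htrim : (μ.withDensity fun ω => ENNReal.ofReal ((μ[f | m]) ω)).trim hm
      = (μ.withDensity fun ω => ENNReal.ofReal (f ω)).trim hm := by
    refine @Measure.ext _ m _ _ fun s hs => ?_
    rw [trim_measurableSet_eq hm hs, trim_measurableSet_eq hm hs,
      withDensity_apply _ (hm s hs), withDensity_apply _ (hm s hs),
      ← ofReal_integral_eq_lintegral_ofReal hf.integrableOn (ae_restrict_of_ae hf_nonneg),
      ← ofReal_integral_eq_lintegral_ofReal integrable_condExp.integrableOn
        (ae_restrict_of_ae (condExp_nonneg hf_nonneg)),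
      setIntegral_condExp hm hf hs]
  have hg' : Measurable g := hg.mono hm le_rfl
  have h := congrArg (fun ν : @Measure Ω m => ∫⁻ ω, g ω ∂ν) htrim
  simp only [lintegral_trim hm hg] at h
  rw [lintegral_withDensity_eq_lintegral_mul₀ hc' hg'.aemeasurable,
    lintegral_withDensity_eq_lintegral_mul₀ hf' hg'.aemeasurable] at h
  simpa only [Pi.mul_apply, mul_comm] using h

/-- Under conditional independence given `m` and overlap, reweighting by the inverse of the
conditional probability of `A` on `A` leaves the law of `Z` unchanged. -/
lemma map_withDensity_indicator_div_condExp {Ω β : Type*} {m mΩ : MeasurableSpace Ω}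
    [MeasurableSpace β] (hm : m ≤ mΩ) {μ : Measure Ω} [IsFiniteMeasure μ]
    {A : Set Ω} (hA : MeasurableSet A) {Z : Ω → β} (hZ : Measurable Z)
    (hindep : ∀ t, MeasurableSet t →
      μ⟦A ∩ Z ⁻¹' t | m⟧ =ᵐ[μ] fun ω => (μ⟦A | m⟧) ω * (μ⟦Z ⁻¹' t | m⟧) ω)
    (hpos : ∀ᵐ ω ∂μ, 0 < (μ⟦A | m⟧) ω) :
    (μ.withDensity fun ω =>
      ENNReal.ofReal (A.indicator (fun _ => (1 : ℝ)) ω / (μ⟦A | m⟧) ω)).map Z = μ.map Z := by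
  ext t ht
  have hB : MeasurableSet (Z ⁻¹' t) := hZ ht
  have hint : ∀ {s : Set Ω}, MeasurableSet s → Integrable (s.indicator fun _ => (1 : ℝ)) μ :=
    fun hs => (integrable_const 1).indicator hs
  have hnonneg : ∀ s : Set Ω, 0 ≤ᵐ[μ] s.indicator fun _ => (1 : ℝ) :=
    fun s => .of_forall fun ω => Set.indicator_nonneg (fun _ _ => zero_le_one) ω
  have hmeas : Measurable[m] fun ω => ENNReal.ofReal ((μ⟦A | m⟧) ω)⁻¹ :=
    stronglyMeasurable_condExp.measurable.inv.ennreal_ofReal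
  rw [Measure.map_apply hZ ht, Measure.map_apply hZ ht, withDensity_apply _ hB,
    ← lintegral_indicator hB]
  calc ∫⁻ ω, (Z ⁻¹' t).indicator (fun ω => ENNReal.ofReal
          (A.indicator (fun _ => (1 : ℝ)) ω / (μ⟦A | m⟧) ω)) ω ∂μ
      = ∫⁻ ω, ENNReal.ofReal ((μ⟦A | m⟧) ω)⁻¹
          * ENNReal.ofReal ((A ∩ Z ⁻¹' t).indicator (fun _ => (1 : ℝ)) ω) ∂μ := by
        refine lintegral_congr fun ω => ?_
        by_cases h1 : ω ∈ A <;> by_cases h2 : ω ∈ Z ⁻¹' t <;>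
          simp only [Set.indicator, Set.mem_inter_iff, h1, h2, and_self, and_true, and_false,
            if_true, if_false, one_div, zero_div, ENNReal.ofReal_one, ENNReal.ofReal_zero,
            mul_one, mul_zero]
    _ = ∫⁻ ω, ENNReal.ofReal ((μ⟦A | m⟧) ω)⁻¹
          * ENNReal.ofReal ((μ⟦A ∩ Z ⁻¹' t | m⟧) ω) ∂μ :=
        (lintegral_mul_ofReal_condExp hm (hint (hA.inter hB)) (hnonneg _) hmeas).symm
    _ = ∫⁻ ω, 1 * ENNReal.ofReal ((μ⟦Z ⁻¹' t | m⟧) ω) ∂μ := by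
        refine lintegral_congr_ae ?_
        filter_upwards [hindep t ht, hpos] with ω h1 h2
        rw [h1, ← ENNReal.ofReal_mul (inv_nonneg.2 h2.le), inv_mul_cancel_left₀ h2.ne', one_mul]
    _ = ∫⁻ ω, 1 * ENNReal.ofReal ((Z ⁻¹' t).indicator (fun _ => (1 : ℝ)) ω) ∂μ :=
        lintegral_mul_ofReal_condExp hm (hint hB) (hnonneg _) measurable_const
    _ = μ (Z ⁻¹' t) := by
        rw [← lintegral_indicator_one hB]
        refine lintegral_congr fun ω => ?_
        by_cases h : ω ∈ Z ⁻¹' t <;> simp [Set.indicator, h]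

/-- **Inverse propensity weighting identifies the treated mean.**
For covariates `X`, binary treatment `W`, potential outcomes `Y(0), Y(1)` with
observed outcome `Y = (1−W)Y(0) + W·Y(1)` and propensity score `e(X) = E[W | X]`:
under ignorability (`W ⫫ (Y(0),Y(1)) | X`), overlap (`e(X) > 0` a.s.) and
integrability of `Y(1)`, one has `E[W·Y / e(X)] = E[Y(1)] = μ₁`. -/
theorem ipw_identifies_treated_mean
    {Ω : Type*} [mΩ : MeasurableSpace Ω] [StandardBorelSpace Ω] [Nonempty Ω]
    (μ : Measure Ω) [IsProbabilityMeasure μ]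
    {d : ℕ} (X : Ω → (Fin d → ℝ)) (W : Ω → ℝ) (Y0 Y1 : Ω → ℝ)
    (hX : Measurable X) (hW : Measurable W)
    (hY0 : Measurable Y0) (hY1 : Measurable Y1)
    (hWbin : ∀ ω, W ω = 0 ∨ W ω = 1)
    (ignorability : CondIndepFun (MeasurableSpace.comap X inferInstance) hX.comap_le
      W (fun ω => (Y0 ω, Y1 ω)) μ)
    (overlap : ∀ᵐ ω ∂μ, 0 < (μ[W | MeasurableSpace.comap X inferInstance]) ω)
    (hint : Integrable Y1 μ)
    (Y : Ω → ℝ) (hY : Y = fun ω => (1 - W ω) * Y0 ω + W ω * Y1 ω) :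
    ∫ ω, W ω * Y ω / (μ[W | MeasurableSpace.comap X inferInstance]) ω ∂μ
      = ∫ ω, Y1 ω ∂μ := by
  have hm := hX.comap_le
  have hA : MeasurableSet (W ⁻¹' {1}) := hW (measurableSet_singleton 1)
  have hWA : W = (W ⁻¹' {1}).indicator fun _ => (1 : ℝ) := by
    funext ω
    rcases hWbin ω with h | h <;> simp [Set.indicator, h]
  have hindep := (condIndepFun_iff_condExp_inter_preimage_eq_mul hW hY1).1
    (ignorability.comp measurable_id measurable_snd)
  have hmap := map_withDensity_indicator_div_condExp hm hA hY1
    (fun t ht => hindep {1} t (measurableSet_singleton 1) ht) (by rwa [← hWA])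
  rw [← hWA] at hmap
  set e : Ω → ℝ := μ[W | MeasurableSpace.comap X inferInstance]
  have he : Measurable e := (stronglyMeasurable_condExp.mono hm).measurable
  have hdens : Measurable fun ω => ENNReal.ofReal (W ω / e ω) :=
    (hW.div he).ennreal_ofReal
  calc ∫ ω, W ω * Y ω / e ω ∂μ
      = ∫ ω, (ENNReal.ofReal (W ω / e ω)).toReal • Y1 ω ∂μ := by
        refine integral_congr_ae ?_
        filter_upwards [overlap] with ω hω
        rcases hWbin ω with h | h
        · simp [h]
        · rw [ENNReal.toReal_ofReal (div_nonneg (by simp [h]) hω.le), hY, smul_eq_mul]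
          simp only [h]
          ring
    _ = ∫ ω, Y1 ω ∂(μ.withDensity fun ω => ENNReal.ofReal (W ω / e ω)) :=
        (integral_withDensity_eq_integral_toReal_smul hdens
          (.of_forall fun _ => ENNReal.ofReal_lt_top) _).symm
    _ = ∫ y, y ∂((μ.withDensity fun ω => ENNReal.ofReal (W ω / e ω)).map Y1) :=
        (integral_map hY1.aemeasurable aestronglyMeasurable_id).symm
    _ = ∫ ω, Y1 ω ∂μ := by
        rw [hmap]
        exact integral_map hY1.aemeasurable aestronglyMeasurable_id
end

section
/- Existence (and uniqueness under strict convexity) of balancing weights: let 𝒵 be a set, Z_1, …, Z_n ∈ 𝒵, and let M be a nonempty absolutely convex (convex and balanced) set of functions m: 𝒵 → ℝ. Let h_1, …, h_n be real-valued linear functionals on the linear span of M with sup_{m∈M} h_i(m) < ∞ and sup_{m∈M} m(Z_i) < ∞ for each i. Let each χ_i: ℝ → ℝ be convex, lower semicontinuous, and coercive (χ_i(x) → ∞ as |x| → ∞) with χ_i(0) = 0, and let ζ: ℝ → ℝ be convex, lower semicontinuous, and nondecreasing with ζ(0) = 0. Define p(γ) = Σ_{i=1}^n χ_i(γ_i)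 + ζ( sup_{m∈M} [ Σ_{i=1}^n h_i(m) − γ_i m(Z_i) ] ) for γ ∈ ℝⁿ. Then the inner supremum is finite and nonnegative for every γ, p is a real-valued convex lower semicontinuous coercive function on ℝⁿ, and p attains its minimum; if moreover each χ_i is strictly convex, the minimizer is unique. -/
open Filter

/-- A convex real-valued function on `ι → ℝ` is continuous. -/
lemma ConvexOn.continuous_of_pi {ι : Type*} [Fintype ι] {f : (ι → ℝ) → ℝ}
    (hf : ConvexOn ℝ Set.univ f) : Continuous f := by
  rw [← continuousOn_univ]
  exact hf.continuousOn isOpen_univ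

/-- A sum of coercive functions of separate variables, each bounded below, is coercive. -/
lemma tendsto_sum_apply_cocompact_atTop {ι : Type*} [Fintype ι] {f : ι → ℝ → ℝ} {c : ι → ℝ}
    (hc : ∀ i x, c i ≤ f i x) (hf : ∀ i, Tendsto (f i) (cocompact ℝ) atTop) :
    Tendsto (fun x : ι → ℝ => ∑ i, f i (x i)) (cocompact (ι → ℝ)) atTop := by
  classical
  rw [← Filter.coprodᵢ_cocompact, Filter.coprodᵢ, tendsto_iSup]
  intro i
  have hi : Tendsto (fun x : ι → ℝ => f i (x i))
      (comap (Function.eval i) (cocompact ℝ)) atTop := (hf i).comp tendsto_comap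
  refine tendsto_atTop_mono (fun x => ?_)
    (tendsto_atTop_add_const_right _ (∑ j ∈ Finset.univ.erase i, c j) hi)
  rw [← Finset.add_sum_erase _ _ (Finset.mem_univ i)]
  gcongr with j
  exact hc j _

/-- The pointwise supremum of a nonempty, pointwise bounded family of convex functions is
convex. -/
lemma convexOn_univ_iSup {E ι : Type*} [AddCommGroup E] [Module ℝ E] [Nonempty ι]
    {f : ι → E → ℝ} (hf : ∀ i, ConvexOn ℝ Set.univ (f i))
    (hbdd : ∀ x, BddAbove (Set.range fun i => f i x)) :
    ConvexOn ℝ Set.univ fun x => ⨆ i, f i x := by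
  refine ⟨convex_univ, fun x _ y _ a b ha hb hab => ciSup_le fun i => ?_⟩
  refine ((hf i).2 (Set.mem_univ x) (Set.mem_univ y) ha hb hab).trans ?_
  gcongr
  · exact le_ciSup (hbdd x) i
  · exact le_ciSup (hbdd y) i

/-- **Existence (and uniqueness under strict convexity) of balancing weights.**
For points `Z_1, …, Z_n` in a set `𝒵`, a nonempty absolutely convex model `M` of
functions `𝒵 → ℝ`, linear functionals `h_i` on the span of `M` with
`sup_{m∈M} h_i(m) < ∞` and `sup_{m∈M} m(Z_i) < ∞`, convex lsc coercive dispersion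
measures `χ_i` with `χ_i(0) = 0` and a convex lsc nondecreasing `ζ` with `ζ(0) = 0`,
the objective `p(γ) = Σ χ_i(γ_i) + ζ(sup_{m∈M}[Σ h_i(m) − γ_i m(Z_i)])` has a
well-defined (finite, nonnegative) inner supremum, is real-valued, convex, lsc and
coercive, and attains its minimum; if each `χ_i` is strictly convex the minimizer is
unique. -/
theorem balancing_weights_exist_and_unique
    {𝒵 : Type*} {n : ℕ} (Z : Fin n → 𝒵)
    (M : Set (𝒵 → ℝ)) (hMne : M.Nonempty)
    (hMconv : Convex ℝ M) (hMbal : Balanced ℝ M)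
    (h : Fin n → (Submodule.span ℝ M →ₗ[ℝ] ℝ))
    (hhbdd : ∀ i, BddAbove
      ((fun m : Submodule.span ℝ M => h i m) '' {m | (m : 𝒵 → ℝ) ∈ M}))
    (hZbdd : ∀ i, BddAbove ((fun m : 𝒵 → ℝ => m (Z i)) '' M))
    (χ : Fin n → ℝ → ℝ)
    (hχconv : ∀ i, ConvexOn ℝ Set.univ (χ i))
    (hχlsc : ∀ i, LowerSemicontinuous (χ i))
    (hχcoercive : ∀ i, Tendsto (χ i) (cocompact ℝ) atTop)
    (hχzero : ∀ i, χ i 0 = 0)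
    (ζ : ℝ → ℝ)
    (hζconv : ConvexOn ℝ Set.univ ζ) (hζlsc : LowerSemicontinuous ζ)
    (hζmono : Monotone ζ) (hζzero : ζ 0 = 0)
    (S : (Fin n → ℝ) → Set ℝ)
    (hS : ∀ γ, S γ = {v | ∃ m : 𝒵 → ℝ, ∃ hm : m ∈ M,
      v = ∑ i, (h i ⟨m, Submodule.subset_span hm⟩ - γ i * m (Z i))})
    (p : (Fin n → ℝ) → ℝ)
    (hp : ∀ γ, p γ = ∑ i, χ i (γ i) + ζ (sSup (S γ))) :
    (∀ γ, BddAbove (S γ) ∧ 0 ≤ sSup (S γ)) ∧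
    ConvexOn ℝ Set.univ p ∧
    LowerSemicontinuous p ∧
    Tendsto p (cocompact (Fin n → ℝ)) atTop ∧
    (∃ γ, ∀ γ', p γ ≤ p γ') ∧
    ((∀ i, StrictConvexOn ℝ Set.univ (χ i)) → ∃! γ, ∀ γ', p γ ≤ p γ') := by
  have hM0 : (0 : 𝒵 → ℝ) ∈ M := hMbal.zero_mem hMne
  have hMneg : ∀ m ∈ M, -m ∈ M := fun m hm => hMbal.neg_mem_iff.2 hm
  have hSsup : ∀ γ, S γ = Set.range fun m : M =>
      ∑ i, (h i ⟨m, Submodule.subset_span m.2⟩ - γ i * (m : 𝒵 → ℝ) (Z i)) := by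
    intro γ
    rw [hS]
    ext v
    constructor
    · rintro ⟨m, hm, rfl⟩
      exact ⟨⟨m, hm⟩, rfl⟩
    · rintro ⟨m, rfl⟩
      exact ⟨m, m.2, rfl⟩
  have hbdd : ∀ γ, BddAbove (S γ) := by
    intro γ
    choose H hH using hhbdd
    choose C hC using hZbdd
    refine ⟨∑ i, (H i + |γ i| * C i), ?_⟩
    rw [hSsup]
    rintro _ ⟨⟨m, hm⟩, rfl⟩
    refine Finset.sum_le_sum fun i _ => ?_
    have hhi : h i ⟨m, Submodule.subset_span hm⟩ ≤ H i := hH i ⟨_, hm, rfl⟩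
    have hpos : m (Z i) ≤ C i := hC i ⟨m, hm, rfl⟩
    have hneg : -m (Z i) ≤ C i := hC i ⟨-m, hMneg m hm, rfl⟩
    have habs : |m (Z i)| ≤ C i := abs_le'.2 ⟨hpos, hneg⟩
    have hmul : -(γ i * m (Z i)) ≤ |γ i| * C i :=
      (neg_le_abs _).trans (by rw [abs_mul]; gcongr)
    simp only
    linarith
  have hnonneg : ∀ γ, 0 ≤ sSup (S γ) := by
    intro γ
    refine le_csSup (hbdd γ) ?_
    rw [hS]
    refine ⟨0, hM0, ?_⟩
    have hzero : (⟨0, Submodule.subset_span hM0⟩ : Submodule.span ℝ M) = 0 := rfl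
    simp [hzero]
  have hsupconv : ConvexOn ℝ Set.univ fun γ => sSup (S γ) := by
    have : Nonempty M := hMne.to_subtype
    simp only [hSsup] at hbdd ⊢
    refine convexOn_univ_iSup (fun m => ⟨convex_univ, fun x _ y _ a b _ _ hab => le_of_eq ?_⟩) hbdd
    simp only [smul_eq_mul, Finset.mul_sum, ← Finset.sum_add_distrib, Pi.add_apply, Pi.smul_apply]
    refine Finset.sum_congr rfl fun i _ => ?_
    linear_combination (-h i ⟨m, Submodule.subset_span m.2⟩) * hab
  have hζsup : ConvexOn ℝ Set.univ fun γ => ζ (sSup (S γ)) :=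
    ⟨convex_univ, fun x hx y hy a b ha hb hab => (hζmono (hsupconv.2 hx hy ha hb hab)).trans
      (hζconv.2 (Set.mem_univ _) (Set.mem_univ _) ha hb hab)⟩
  have hχsum : ConvexOn ℝ Set.univ fun γ : Fin n → ℝ => ∑ i, χ i (γ i) := by
    refine ⟨convex_univ, fun x _ y _ a b ha hb hab => ?_⟩
    simp only [smul_eq_mul, Finset.mul_sum, ← Finset.sum_add_distrib]
    exact Finset.sum_le_sum fun i _ =>
      (hχconv i).2 (Set.mem_univ (x i)) (Set.mem_univ (y i)) ha hb hab
  obtain rfl : p = fun γ => ∑ i, χ i (γ i) + ζ (sSup (S γ)) := funext hp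
  have hpconv : ConvexOn ℝ Set.univ fun γ => ∑ i, χ i (γ i) + ζ (sSup (S γ)) :=
    hχsum.add hζsup
  have hpcont := hpconv.continuous_of_pi
  have hχmin : ∀ i, ∃ x, ∀ y, χ i x ≤ χ i y := fun i =>
    (continuousOn_univ.1 ((hχconv i).continuousOn isOpen_univ)).exists_forall_le (hχcoercive i)
  choose x₀ hx₀ using hχmin
  have hpcoercive : Tendsto (fun γ => ∑ i, χ i (γ i) + ζ (sSup (S γ)))
      (cocompact (Fin n → ℝ)) atTop :=
    tendsto_atTop_mono
      (fun γ => le_add_of_nonneg_right (hζzero.symm.trans_le (hζmono (hnonneg γ))))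
      (tendsto_sum_apply_cocompact_atTop hx₀ hχcoercive)
  have hmin := hpcont.exists_forall_le hpcoercive
  refine ⟨fun γ => ⟨hbdd γ, hnonneg γ⟩, hpconv, hpcont.lowerSemicontinuous, hpcoercive, hmin,
    fun hχstrict => ?_⟩
  have hsumstrict : StrictConvexOn ℝ Set.univ fun γ : Fin n → ℝ => ∑ i, χ i (γ i) := by
    refine ⟨convex_univ, fun x _ y _ hxy a b ha hb hab => ?_⟩
    obtain ⟨j, hj⟩ := Function.ne_iff.1 hxy
    simp only [smul_eq_mul, Finset.mul_sum, ← Finset.sum_add_distrib]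
    exact Finset.sum_lt_sum
      (fun i _ => (hχconv i).2 (Set.mem_univ (x i)) (Set.mem_univ (y i)) ha.le hb.le hab)
      ⟨j, Finset.mem_univ j,
        (hχstrict j).2 (Set.mem_univ (x j)) (Set.mem_univ (y j)) hj ha hb hab⟩
  obtain ⟨γ, hγ⟩ := hmin
  exact ⟨γ, hγ, fun γ' hγ' => (hsumstrict.add_convexOn hζsup).eq_of_isMinOn
    (fun y _ => hγ' y) (fun y _ => hγ y) (Set.mem_univ _) (Set.mem_univ _)⟩
end

section
/- Midpoint strict-convexity lemma for minimizing sequences: let f: ℝ → ℝ be strictly convex and continuous, and let (a_j) and (b_j) be bounded real sequences such that f(a_j) + f(b_j) − 2·f((a_j + b_j)/2) → 0 as j → ∞. Then a_j − b_j → 0. -/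
open Filter

/-- **Midpoint strict-convexity lemma for minimizing sequences.**
If `f : ℝ → ℝ` is strictly convex and continuous and `(a_j)`, `(b_j)` are bounded real
sequences with `f(a_j) + f(b_j) − 2 f((a_j + b_j)/2) → 0`, then `a_j − b_j → 0`. -/
theorem midpoint_strict_convexity_minimizing_sequences
    (f : ℝ → ℝ) (hf : StrictConvexOn ℝ Set.univ f) (hfc : Continuous f)
    (a b : ℕ → ℝ) (C : ℝ)
    (hab : ∀ j, |a j| ≤ C ∧ |b j| ≤ C)
    (hgap : Tendsto (fun j => f (a j) + f (b j) - 2 * f ((a j + b j) / 2))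
      atTop (nhds 0)) :
    Tendsto (fun j => a j - b j) atTop (nhds 0) := by
  refine tendsto_of_subseq_tendsto fun ns hns => ?_
  have hmem : ∀ n, (a (ns n), b (ns n)) ∈ Set.Icc (-C) C ×ˢ Set.Icc (-C) C := fun n =>
    ⟨abs_le.mp (hab _).1, abs_le.mp (hab _).2⟩
  obtain ⟨⟨x, y⟩, -, ms, hms, hlim⟩ := (isCompact_Icc.prod isCompact_Icc).tendsto_subseq hmem
  have ha : Tendsto (fun n => a (ns (ms n))) atTop (nhds x) :=
    (continuous_fst.tendsto _).comp hlim
  have hb : Tendsto (fun n => b (ns (ms n))) atTop (nhds y) :=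
    (continuous_snd.tendsto _).comp hlim
  have hgap_lim : f x + f y - 2 * f ((x + y) / 2) = 0 :=
    tendsto_nhds_unique
      ((((hfc.tendsto x).comp ha).add ((hfc.tendsto y).comp hb)).sub
        (((hfc.tendsto _).comp ((ha.add hb).div_const 2)).const_mul 2))
      (hgap.comp (hns.comp hms.tendsto_atTop))
  have hxy : x = y := by
    by_contra hne
    have h := hf.2 (Set.mem_univ x) (Set.mem_univ y) hne
      (show (0 : ℝ) < 1 / 2 by norm_num) (show (0 : ℝ) < 1 / 2 by norm_num) (by norm_num)
    simp only [smul_eq_mul] at h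
    rw [show 1 / 2 * x + 1 / 2 * y = (x + y) / 2 by ring] at h
    linarith
  refine ⟨ms, ?_⟩
  simpa [hxy] using ha.sub hb
end

section
/- Lagrangian duality for stable balancing weights with a quadratic dispersion penalty (the lasso minimum-distance estimator of the inverse propensity score): fix points X_1, …, X_n ∈ ℝ^d, treatment indicators W_i ∈ {0,1}, a basis map φ: ℝ^d → ℝ^p, and scale factors λ_j > 0, j = 1,…,p. Consider the primal problem: minimize (1/2n)Σ_{i=1}^n W_i γ_i² over γ ∈ ℝⁿ subject to |(1/n)Σ_{i=1}^n W_i γ_i φ_j(X_i) − (1/n)Σ_{i=1}^n φ_j(X_i)| ≤ 1/λ_j for all j. If θ̂ ∈ ℝ^p minimizes the dual objective F(θ) = (1/2n)Σ_{i=1}^n W_i (θ·φ(X_i))² − (1/n)Σ_{i=1}^n θ·φ(X_i) + Σ_{j=1}^p |θ_j|/λ_j, then the vector γ̂ defined by γ̂_i = θ̂·φ(X_i) when W_i = 1 (and γ̂_i = 0 when W_i = 0) is feasible for the primal problem and minimizes it. -/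
/-- A linear function plus a quadratic remainder that is nonnegative on `(0, 1)` has nonnegative
slope at the origin. -/
lemma nonneg_of_forall_nonneg_linear_add_quadratic {x q : ℝ}
    (h : ∀ t : ℝ, 0 < t → t < 1 → 0 ≤ t * x + t ^ 2 * q) : 0 ≤ x := by
  have hx : ∀ t : ℝ, 0 < t → t < 1 → 0 ≤ x + t * q := fun t ht ht1 => by
    have := h t ht ht1
    have : 0 ≤ t * (x + t * q) := by linarith
    exact nonneg_of_mul_nonneg_right this ht
  have hlim : Filter.Tendsto (fun t : ℝ => x + t * q) (nhdsWithin 0 (Set.Ioi 0)) (nhds x) := by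
    have : Continuous fun t : ℝ => x + t * q := by fun_prop
    simpa using (this.tendsto 0).mono_left nhdsWithin_le_nhds
  refine ge_of_tendsto hlim ?_
  filter_upwards [Ioo_mem_nhdsGT (zero_lt_one' ℝ)] with t ht using hx t ht.1 ht.2

/-- The variational inequality satisfied by a minimizer of a weighted quadratic with a linear term
and a weighted `ℓ¹` penalty. -/
lemma lasso_variational_inequality {ι κ : Type*} [Fintype ι] [Fintype κ]
    (A : ι → κ → ℝ) (W : ι → ℝ) (lam : κ → ℝ) (hlam : ∀ j, 0 < lam j) (c : ℝ) (θ : κ → ℝ)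
    (hmin : ∀ η : κ → ℝ,
      c / 2 * ∑ i, W i * (∑ j, θ j * A i j) ^ 2 - c * ∑ i, ∑ j, θ j * A i j + ∑ j, |θ j| / lam j
        ≤ c / 2 * ∑ i, W i * (∑ j, η j * A i j) ^ 2 - c * ∑ i, ∑ j, η j * A i j
          + ∑ j, |η j| / lam j)
    (v : κ → ℝ) :
    0 ≤ c * ∑ i, W i * (∑ j, θ j * A i j) * (∑ j, v j * A i j) - c * ∑ i, ∑ j, v j * A i j
      + (∑ j, |θ j + v j| / lam j - ∑ j, |θ j| / lam j) := by
  refine nonneg_of_forall_nonneg_linear_add_quadratic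
    (q := c / 2 * ∑ i, W i * (∑ j, v j * A i j) ^ 2) fun t ht ht1 => ?_
  have hpen : ∑ j, |θ j + t * v j| / lam j
      ≤ (1 - t) * ∑ j, |θ j| / lam j + t * ∑ j, |θ j + v j| / lam j := by
    rw [Finset.mul_sum, Finset.mul_sum, ← Finset.sum_add_distrib]
    refine Finset.sum_le_sum fun j _ => ?_
    rw [← mul_div_assoc, ← mul_div_assoc, ← add_div]
    refine div_le_div_of_nonneg_right ?_ (hlam j).le
    calc |θ j + t * v j| = |(1 - t) * θ j + t * (θ j + v j)| := by ring_nf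
      _ ≤ |(1 - t) * θ j| + |t * (θ j + v j)| := abs_add_le _ _
      _ = (1 - t) * |θ j| + t * |θ j + v j| := by
        rw [abs_mul, abs_mul, abs_of_pos ht, abs_of_pos (sub_pos.2 ht1)]
  have hlin : ∀ i, ∑ j, (θ j + t * v j) * A i j
      = ∑ j, θ j * A i j + t * ∑ j, v j * A i j := fun i => by
    rw [Finset.mul_sum, ← Finset.sum_add_distrib]
    exact Finset.sum_congr rfl fun j _ => by ring
  have hquad : ∑ i, W i * (∑ j, θ j * A i j + t * ∑ j, v j * A i j) ^ 2
      = ∑ i, W i * (∑ j, θ j * A i j) ^ 2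
        + 2 * t * ∑ i, W i * (∑ j, θ j * A i j) * (∑ j, v j * A i j)
        + t ^ 2 * ∑ i, W i * (∑ j, v j * A i j) ^ 2 := by
    rw [Finset.mul_sum, Finset.mul_sum, ← Finset.sum_add_distrib, ← Finset.sum_add_distrib]
    exact Finset.sum_congr rfl fun i _ => by ring
  have h := hmin fun j => θ j + t * v j
  simp only [hlin, hquad, Finset.sum_add_distrib (s := (Finset.univ : Finset ι)),
    ← Finset.mul_sum] at h
  linarith


/-- **Lagrangian duality for balancing weights with a quadratic dispersion penalty
(the lasso minimum-distance estimator of the inverse propensity score).**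
If `θ̂` minimizes the dual objective
`F(θ) = (1/2n)Σ W_i (θ·φ(X_i))² − (1/n)Σ θ·φ(X_i) + Σ_j |θ_j|/λ_j`,
then the weights `γ̂_i = θ̂·φ(X_i)` on treated units (`0` on controls) are feasible for
the primal balance constraints and minimize `(1/2n)Σ W_i γ_i²` among feasible `γ`. -/
theorem lasso_minimum_distance_duality
    {d p n : ℕ}
    (X : Fin n → (Fin d → ℝ)) (W : Fin n → ℝ)
    (hW : ∀ i, W i = 0 ∨ W i = 1)
    (φ : (Fin d → ℝ) → (Fin p → ℝ))
    (lam : Fin p → ℝ) (hlam : ∀ j, 0 < lam j)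
    (F : (Fin p → ℝ) → ℝ)
    (hF : ∀ θ, F θ =
        (1 / (2 * (n : ℝ))) * ∑ i, W i * (∑ j, θ j * φ (X i) j) ^ 2
          - (1 / (n : ℝ)) * ∑ i, (∑ j, θ j * φ (X i) j)
          + ∑ j, |θ j| / lam j)
    (θhat : Fin p → ℝ) (hθhat : ∀ θ, F θhat ≤ F θ)
    (γhat : Fin n → ℝ)
    (hγhat : ∀ i, γhat i = if W i = 1 then ∑ j, θhat j * φ (X i) j else 0)
    (Feasible : (Fin n → ℝ) → Prop)
    (hFeasible : ∀ γ, Feasible γ ↔ ∀ j,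
        |(1 / (n : ℝ)) * ∑ i, W i * γ i * φ (X i) j
            - (1 / (n : ℝ)) * ∑ i, φ (X i) j| ≤ 1 / lam j) :
    Feasible γhat ∧
      ∀ γ, Feasible γ →
        (1 / (2 * (n : ℝ))) * ∑ i, W i * γhat i ^ 2
          ≤ (1 / (2 * (n : ℝ))) * ∑ i, W i * γ i ^ 2 := by
  have hobj : ∀ η : Fin p → ℝ, F η = 1 / (n : ℝ) / 2 * ∑ i, W i * (∑ j, η j * φ (X i) j) ^ 2
      - 1 / (n : ℝ) * ∑ i, ∑ j, η j * φ (X i) j + ∑ j, |η j| / lam j := fun η => by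
    rw [hF]; ring
  have hvar := lasso_variational_inequality (fun i j => φ (X i) j) W lam hlam (1 / (n : ℝ)) θhat
    fun η => by simpa only [hobj] using hθhat η
  have hc : 1 / (2 * (n : ℝ)) = 1 / (n : ℝ) / 2 := by ring
  have hc0 : 0 ≤ 1 / (n : ℝ) := by positivity
  rw [hc]
  generalize 1 / (n : ℝ) = c at *
  have hWγ : ∀ i, W i * γhat i = W i * ∑ j, θhat j * φ (X i) j := fun i => by
    rcases hW i with h | h <;> simp [hγhat, h]
  have hpen : ∀ j (s : ℝ), |s| = 1 → ∑ k, |θhat k + (Pi.single j s : Fin p → ℝ) k| / lam k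
      - ∑ k, |θhat k| / lam k ≤ 1 / lam j := fun j s hs => by
    rw [← Finset.sum_sub_distrib]
    calc _ ≤ ∑ k, (Pi.single j (1 / lam j) : Fin p → ℝ) k := by
          refine Finset.sum_le_sum fun k _ => ?_
          rcases eq_or_ne k j with rfl | hk
          · rw [Pi.single_eq_same, Pi.single_eq_same, ← sub_div]
            exact div_le_div_of_nonneg_right
              (by linarith [abs_add_le (θhat k) s]) (hlam k).le
          · simp [hk]
      _ = 1 / lam j := by simp
  have hsingle : ∀ j (s : ℝ) i, ∑ k, (Pi.single j s : Fin p → ℝ) k * φ (X i) k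
      = s * φ (X i) j := fun j s i => by
    simp [Pi.single_apply]
  refine ⟨(hFeasible γhat).2 fun j => ?_, fun γ hγ => ?_⟩
  · simp only [hWγ]
    have hp := hvar (Pi.single j 1)
    have hm := hvar (Pi.single j (-1))
    have hp' := hpen j 1 (by simp)
    have hm' := hpen j (-1) (by simp)
    simp only [hsingle, one_mul, neg_one_mul, mul_neg, Finset.sum_neg_distrib] at hp hm
    rw [abs_le]
    constructor <;> linarith
  · have hcomp := hvar fun j => -θhat j
    simp only [neg_mul, mul_neg, Finset.sum_neg_distrib, add_neg_cancel, abs_zero, zero_div,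
      Finset.sum_const_zero] at hcomp
    have hdual : ∀ j, -(|θhat j| / lam j)
        ≤ θhat j * (c * ∑ i, W i * γ i * φ (X i) j - c * ∑ i, φ (X i) j) := fun j => by
      refine (abs_le.1 ?_).1
      rw [abs_mul, div_eq_mul_one_div]
      exact mul_le_mul_of_nonneg_left ((hFeasible γ).1 hγ j) (abs_nonneg _)
    have hsum := Finset.sum_le_sum fun j (_ : j ∈ Finset.univ) => hdual j
    have hswap : ∀ u : Fin n → ℝ, ∑ j, θhat j * (c * ∑ i, u i * φ (X i) j)
        = c * ∑ i, u i * ∑ j, θhat j * φ (X i) j := fun u => by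
      simp only [Finset.mul_sum]
      rw [Finset.sum_comm]
      exact Finset.sum_congr rfl fun i _ => Finset.sum_congr rfl fun j _ => by ring
    have hswap_one := hswap fun _ => 1
    simp only [one_mul] at hswap_one
    simp only [mul_sub, Finset.sum_sub_distrib, hswap, hswap_one, Finset.sum_neg_distrib] at hsum
    have hsq : ∑ i, W i * γhat i ^ 2
        = ∑ i, W i * (∑ j, θhat j * φ (X i) j) * ∑ j, θhat j * φ (X i) j :=
      Finset.sum_congr rfl fun i _ => by
        rcases hW i with h | h <;> simp [hγhat, h, sq]
    have hyoung : 2 * ∑ i, W i * γ i * ∑ j, θhat j * φ (X i) j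
        ≤ ∑ i, W i * γ i ^ 2
          + ∑ i, W i * (∑ j, θhat j * φ (X i) j) * ∑ j, θhat j * φ (X i) j := by
      rw [Finset.mul_sum, ← Finset.sum_add_distrib]
      refine Finset.sum_le_sum fun i _ => ?_
      have hWi : 0 ≤ W i := by rcases hW i with h | h <;> simp [h]
      linarith [mul_nonneg hWi (sq_nonneg (γ i - ∑ j, θhat j * φ (X i) j))]
    rw [hsq]
    linarith [mul_le_mul_of_nonneg_left hyoung hc0]
end

section
/- Lagrangian duality for entropy balancing (the regularized calibrated propensity score estimator): fix points X_1, …, X_n ∈ ℝ^d, treatment indicators W_i ∈ {0,1}, a basis map φ: ℝ^d → ℝ^p, and scale factors λ_j > 0, j = 1,…,p. Consider the primal problem: minimize (1/n)Σ_{i=1}^n W_i γ_i (log γ_i − 1) over vectors γ ∈ ℝⁿ with γ_i > 0 whenever W_i = 1, subject to |(1/n)Σ_{i=1}^n W_i γ_i φ_j(X_i) − (1/n)Σ_{i=1}^n φ_j(X_i)| ≤ 1/λ_j for all j. If θ̂ ∈ ℝ^p minimizes the dual objective G(θ) = (1/n)Σ_{i=1}^n W_i exp(θ·φ(X_i)) −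 (1/n)Σ_{i=1}^n θ·φ(X_i) + Σ_{j=1}^p |θ_j|/λ_j, then the vector γ̂ defined by γ̂_i = exp(θ̂·φ(X_i)) when W_i = 1 is feasible for the primal problem and minimizes it. -/
open Filter Topology in
/-- If `f 0 ≤ f t + t * K` for small positive `t`, the derivative of `f` at `0` is at least `-K`. -/
theorem HasDerivAt.neg_le_of_le_add_mul {f : ℝ → ℝ} {f' K : ℝ} (hf : HasDerivAt f f' 0)
    (h : ∀ t, 0 < t → t < 1 → f 0 ≤ f t + t * K) : -K ≤ f' := by
  have hslope : Tendsto (slope f 0) (𝓝[>] 0) (𝓝 f') :=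
    hf.tendsto_slope.mono_left (nhdsWithin_mono _ fun t ht => ne_of_gt ht)
  refine ge_of_tendsto hslope ?_
  filter_upwards [Ioo_mem_nhdsGT (zero_lt_one : (0 : ℝ) < 1)] with t ht
  rw [slope_def_field, sub_zero, le_div_iff₀ ht.1]
  linarith [h t ht.1 ht.2]

/-- The Fenchel–Young inequality for the negative entropy `x * (log x - 1)` and `exp`. -/
theorem Real.mul_sub_exp_le_mul_log_sub_one {x : ℝ} (hx : 0 < x) (a : ℝ) :
    x * a - Real.exp a ≤ x * (Real.log x - 1) := by
  have h := mul_le_mul_of_nonneg_left (Real.add_one_le_exp (a - Real.log x)) hx.le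
  rw [Real.exp_sub, Real.exp_log hx, mul_div_cancel₀ _ hx.ne'] at h
  linarith

section EntropyBalancing

variable {ι κ : Type*} [Fintype ι] [Fintype κ]

/-- The signed imbalance of the `j`-th covariate under the weights `γ`. -/
def imbalance (c : ℝ) (W : ι → ℝ) (m : ι → κ → ℝ) (γ : ι → ℝ) (j : κ) : ℝ :=
  c * ∑ i, W i * γ i * m i j - c * ∑ i, m i j

theorem sum_mul_imbalance (c : ℝ) (W : ι → ℝ) (m : ι → κ → ℝ) (γ : ι → ℝ) (v : κ → ℝ) :
    ∑ j, v j * imbalance c W m γ j =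
      c * ∑ i, W i * (γ i * ∑ j, v j * m i j) - c * ∑ i, ∑ j, v j * m i j := by
  simp only [imbalance, mul_sub, Finset.sum_sub_distrib, Finset.mul_sum]
  congr 1 <;>
  · rw [Finset.sum_comm]
    refine Finset.sum_congr rfl fun i _ => Finset.sum_congr rfl fun j _ => ?_
    ring

/-- The smooth part of the entropy balancing dual objective. -/
noncomputable def smoothDual (c : ℝ) (W : ι → ℝ) (m : ι → κ → ℝ) (θ : κ → ℝ) : ℝ :=
  c * ∑ i, W i * Real.exp (∑ j, θ j * m i j) - c * ∑ i, ∑ j, θ j * m i j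

theorem hasDerivAt_smoothDual (c : ℝ) (W : ι → ℝ) (m : ι → κ → ℝ) (θ v : κ → ℝ) :
    HasDerivAt (fun t : ℝ => smoothDual c W m (θ + t • v))
      (∑ j, v j * imbalance c W m (fun i => Real.exp (∑ j, θ j * m i j)) j) 0 := by
  rw [sum_mul_imbalance]
  have hlin (i : ι) :
      HasDerivAt (fun t : ℝ => ∑ j, (θ + t • v) j * m i j) (∑ j, v j * m i j) 0 := by
    refine HasDerivAt.fun_sum fun j _ => ?_
    simpa using (((hasDerivAt_id (0 : ℝ)).mul_const (v j)).const_add (θ j)).mul_const (m i j)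
  refine HasDerivAt.sub (HasDerivAt.const_mul c ?_) (HasDerivAt.const_mul c ?_)
  · refine HasDerivAt.fun_sum fun i _ => HasDerivAt.const_mul (W i) ?_
    simpa using (hlin i).exp
  · exact HasDerivAt.fun_sum fun i _ => hlin i

/-- First-order condition at a minimizer of the penalized dual, in a direction `v` along which
the penalty grows at rate at most `K`. -/
theorem neg_le_sum_mul_imbalance {c : ℝ} {W : ι → ℝ} {m : ι → κ → ℝ} {θ : κ → ℝ}
    {pen : (κ → ℝ) → ℝ}
    (hmin : ∀ η, smoothDual c W m θ + pen θ ≤ smoothDual c W m η + pen η)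
    {v : κ → ℝ} {K : ℝ} (hpen : ∀ t : ℝ, 0 < t → t < 1 → pen (θ + t • v) ≤ pen θ + t * K) :
    -K ≤ ∑ j, v j * imbalance c W m (fun i => Real.exp (∑ j, θ j * m i j)) j := by
  refine (hasDerivAt_smoothDual c W m θ v).neg_le_of_le_add_mul fun t ht ht1 => ?_
  have h := hmin (θ + t • v)
  have h' := hpen t ht ht1
  simp only [zero_smul, add_zero]
  linarith

/-- The weighted `ℓ¹` penalty is Lipschitz along coordinate directions. -/
theorem sum_abs_div_add_smul_single_le [DecidableEq κ] {lam : κ → ℝ} (hlam : ∀ j, 0 < lam j)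
    (θ : κ → ℝ) (j : κ) (s : ℝ) {t : ℝ} (ht : 0 ≤ t) :
    ∑ k, |(θ + t • (Pi.single j s : κ → ℝ)) k| / lam k ≤ ∑ k, |θ k| / lam k + t * (|s| / lam j) := by
  have hsum : t * (|s| / lam j) = ∑ k, t * (|Pi.single (M := fun _ => ℝ) j s k| / lam k) := by
    rw [Finset.sum_eq_single j] <;> simp +contextual
  rw [hsum, ← Finset.sum_add_distrib]
  refine Finset.sum_le_sum fun k _ => ?_
  have h := abs_add_le (θ k) (t * Pi.single (M := fun _ => ℝ) j s k)
  rw [abs_mul, abs_of_nonneg ht] at h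
  simp only [Pi.add_apply, Pi.smul_apply, smul_eq_mul]
  rw [← mul_div_assoc, ← add_div]
  exact div_le_div_of_nonneg_right h (hlam k).le

/-- Shrinking toward the origin scales the weighted `ℓ¹` penalty. -/
theorem sum_abs_div_add_smul_neg (lam θ : κ → ℝ) {t : ℝ} (ht : t ≤ 1) :
    ∑ k, |(θ + t • -θ) k| / lam k = ∑ k, |θ k| / lam k + t * -∑ k, |θ k| / lam k := by
  have h (k : κ) : |(θ + t • -θ) k| / lam k = (1 - t) * (|θ k| / lam k) := by
    have : (θ + t • -θ) k = (1 - t) * θ k := by simp; ring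
    rw [this, abs_mul, abs_of_nonneg (sub_nonneg.2 ht), mul_div_assoc]
  simp only [h, ← Finset.mul_sum]
  ring

end EntropyBalancing


/-- **Lagrangian duality for entropy balancing (the regularized calibrated
propensity score estimator).**
If `θ̂` minimizes the dual objective
`G(θ) = (1/n)Σ W_i exp(θ·φ(X_i)) − (1/n)Σ θ·φ(X_i) + Σ_j |θ_j|/λ_j`,
then the weights `γ̂_i = exp(θ̂·φ(X_i))` are feasible for the primal balance
constraints and minimize the negative-entropy dispersion `(1/n)Σ W_i γ_i (log γ_i − 1)`
among feasible `γ` with `γ_i > 0` on treated units. -/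
theorem entropy_balancing_duality
    {d p n : ℕ}
    (X : Fin n → (Fin d → ℝ)) (W : Fin n → ℝ)
    (hW : ∀ i, W i = 0 ∨ W i = 1)
    (φ : (Fin d → ℝ) → (Fin p → ℝ))
    (lam : Fin p → ℝ) (hlam : ∀ j, 0 < lam j)
    (G : (Fin p → ℝ) → ℝ)
    (hG : ∀ θ, G θ =
        (1 / (n : ℝ)) * ∑ i, W i * Real.exp (∑ j, θ j * φ (X i) j)
          - (1 / (n : ℝ)) * ∑ i, (∑ j, θ j * φ (X i) j)
          + ∑ j, |θ j| / lam j)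
    (θhat : Fin p → ℝ) (hθhat : ∀ θ, G θhat ≤ G θ)
    (γhat : Fin n → ℝ)
    (hγhat : ∀ i, W i = 1 → γhat i = Real.exp (∑ j, θhat j * φ (X i) j))
    (Feasible : (Fin n → ℝ) → Prop)
    (hFeasible : ∀ γ, Feasible γ ↔ ∀ j,
        |(1 / (n : ℝ)) * ∑ i, W i * γ i * φ (X i) j
            - (1 / (n : ℝ)) * ∑ i, φ (X i) j| ≤ 1 / lam j) :
    ((∀ i, W i = 1 → 0 < γhat i) ∧ Feasible γhat) ∧
      ∀ γ, (∀ i, W i = 1 → 0 < γ i) → Feasible γ →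
        (1 / (n : ℝ)) * ∑ i, W i * γhat i * (Real.log (γhat i) - 1)
          ≤ (1 / (n : ℝ)) * ∑ i, W i * γ i * (Real.log (γ i) - 1) := by
  classical
  have hF (γ) : Feasible γ ↔ ∀ j, |imbalance (1 / (n : ℝ)) W (fun i => φ (X i)) γ j| ≤ 1 / lam j :=
    hFeasible γ
  set c : ℝ := 1 / (n : ℝ)
  have hc : 0 ≤ c := by positivity
  set m : Fin n → Fin p → ℝ := fun i => φ (X i)
  set E : Fin n → ℝ := fun i => Real.exp (∑ j, θhat j * m i j) with hE
  have hmin (η) : smoothDual c W m θhat + ∑ j, |θhat j| / lam j ≤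
      smoothDual c W m η + ∑ j, |η j| / lam j := by
    have h := hθhat η
    rwa [hG, hG] at h
  have hWγ (i) : W i * γhat i = W i * E i := by
    rcases hW i with h | h
    · simp [h]
    · rw [hγhat i h]
  have hbal (j) : imbalance c W m γhat j = imbalance c W m E j := by
    simp only [imbalance, hWγ]
  have hfeas (j) : |imbalance c W m E j| ≤ 1 / lam j := by
    have hdir (s : ℝ) : -(|s| / lam j) ≤ s * imbalance c W m E j := by
      simpa [Pi.single_apply] using
        neg_le_sum_mul_imbalance (pen := fun η => ∑ j, |η j| / lam j) hmin
          fun t ht _ => sum_abs_div_add_smul_single_le hlam θhat j s ht.le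
    have h₁ := hdir 1
    have h₂ := hdir (-1)
    simp only [abs_neg, abs_one] at h₁ h₂
    exact abs_le.2 ⟨by linarith, by linarith⟩
  have hslack : ∑ j, θhat j * imbalance c W m E j ≤ -∑ j, |θhat j| / lam j := by
    have h := neg_le_sum_mul_imbalance (pen := fun η => ∑ j, |η j| / lam j) hmin
      fun t _ ht => (sum_abs_div_add_smul_neg lam θhat ht.le).le
    simp only [Pi.neg_apply, neg_mul, Finset.sum_neg_distrib, neg_neg] at h
    linarith
  refine ⟨⟨fun i hi => hγhat i hi ▸ Real.exp_pos _, (hF _).2 fun j => hbal j ▸ hfeas j⟩, ?_⟩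
  intro γ hγ hγF
  have hpen : -∑ j, |θhat j| / lam j ≤ ∑ j, θhat j * imbalance c W m γ j := by
    rw [← Finset.sum_neg_distrib]
    refine Finset.sum_le_sum fun j _ => ?_
    have h := mul_le_mul_of_nonneg_left ((hF γ).1 hγF j) (abs_nonneg (θhat j))
    rw [← abs_mul, mul_one_div] at h
    exact (abs_le.1 h).1
  have hle := hslack.trans hpen
  rw [sum_mul_imbalance, sum_mul_imbalance] at hle
  have hhat : ∑ i, W i * γhat i * (Real.log (γhat i) - 1) =
      ∑ i, W i * (E i * ∑ j, θhat j * m i j) - ∑ i, W i * E i := by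
    rw [← Finset.sum_sub_distrib]
    refine Finset.sum_congr rfl fun i _ => ?_
    rcases hW i with h | h
    · simp [h]
    · rw [hWγ, hγhat i h, Real.log_exp]
      ring
  have hγle : ∑ i, W i * (γ i * ∑ j, θhat j * m i j) - ∑ i, W i * E i ≤
      ∑ i, W i * γ i * (Real.log (γ i) - 1) := by
    rw [← Finset.sum_sub_distrib]
    refine Finset.sum_le_sum fun i _ => ?_
    rcases hW i with h | h
    · simp [h]
    · simpa [h] using Real.mul_sub_exp_le_mul_log_sub_one (hγ i h) (∑ j, θhat j * m i j)
  have h := mul_le_mul_of_nonneg_left hγle hc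
  rw [hhat]
  rw [mul_sub] at h ⊢
  linarith
end
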